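/- There exists a ⟨1936,1936,1936;1303676064⟩-algorithm over ℚ. -/

import Mathlib

open Matrix

/-- Row-major vectorization: `vec A (n*i+j) = A i j`. -/
def vec {F : Type*} {m n : ℕ} (A : Matrix (Fin m) (Fin n) F) : Fin (m * n) → F :=
  fun r => A r.divNat r.modNat

/-- `⟨U, V, W⟩` is an `⟨m, n, p; t⟩`-algorithm over `F`: for all `A, B, C` of the appropriate
sizes, `trace (A * B * C) = ∑ r, (U ⬝ᵥ vec A) r * (V ⬝ᵥ vec B) r * (W ⬝ᵥ vec C) r`. -/
def IsMMAlg {F : Type*} [Field F] (m n p t : ℕ)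
    (U : Matrix (Fin t) (Fin (m * n)) F)
    (V : Matrix (Fin t) (Fin (n * p)) F)
    (W : Matrix (Fin t) (Fin (p * m)) F) : Prop :=
  ∀ (A : Matrix (Fin m) (Fin n) F) (B : Matrix (Fin n) (Fin p) F) (C : Matrix (Fin p) (Fin m) F),
    (A * B * C).trace =
      ∑ r : Fin t, U.mulVec (vec A) r * V.mulVec (vec B) r * W.mulVec (vec C) r

/-! ### Trilinear forms of bounded rank -/

/-- The trilinear form `T` is a sum of at most `n` products of three linear forms. -/
def TR {E : Type} [AddCommGroup E] [Module ℚ E] (T : E → E → E → ℚ) (n : ℕ) : Prop :=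
  ∃ (κ : Type) (_ : Fintype κ) (u v w : κ → E →ₗ[ℚ] ℚ), Fintype.card κ ≤ n ∧
    ∀ a b c, T a b c = ∑ r, u r a * v r b * w r c

section TRlemmas

variable {E E' : Type} [AddCommGroup E] [Module ℚ E] [AddCommGroup E'] [Module ℚ E']

theorem TR.one (u v w : E →ₗ[ℚ] ℚ) : TR (fun a b c => u a * v b * w c) 1 :=
  ⟨Unit, inferInstance, fun _ => u, fun _ => v, fun _ => w, by simp, by simp⟩

theorem TR.mono {T : E → E → E → ℚ} {m n : ℕ} (h : TR T m) (hmn : m ≤ n) : TR T n := by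
  obtain ⟨κ, i, u, v, w, hc, h⟩ := h
  exact ⟨κ, i, u, v, w, hc.trans hmn, h⟩

theorem TR.congr {T T' : E → E → E → ℚ} {n : ℕ} (h : TR T n)
    (hT : ∀ a b c, T' a b c = T a b c) : TR T' n := by
  obtain ⟨κ, i, u, v, w, hc, h⟩ := h
  exact ⟨κ, i, u, v, w, hc, fun a b c => (hT a b c).trans (h a b c)⟩

theorem TR.add {T T' : E → E → E → ℚ} {m n : ℕ} (h : TR T m) (h' : TR T' n) :
    TR (fun a b c => T a b c + T' a b c) (m + n) := by
  obtain ⟨κ, i, u, v, w, hc, h⟩ := h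
  obtain ⟨κ', i', u', v', w', hc', h'⟩ := h'
  refine ⟨κ ⊕ κ', inferInstance, Sum.elim u u', Sum.elim v v', Sum.elim w w', ?_, ?_⟩
  · rw [Fintype.card_sum]; omega
  · intro a b c
    simp [h, h', Fintype.sum_sum_type]

theorem TR.smul {T : E → E → E → ℚ} {n : ℕ} (q : ℚ) (h : TR T n) :
    TR (fun a b c => q * T a b c) n := by
  obtain ⟨κ, i, u, v, w, hc, h⟩ := h
  refine ⟨κ, i, fun r => q • u r, v, w, hc, ?_⟩
  intro a b c
  simp only [h, Finset.mul_sum, LinearMap.smul_apply, smul_eq_mul]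
  exact Finset.sum_congr rfl fun r _ => by ring

theorem TR.comp {T : E → E → E → ℚ} {n : ℕ} (h : TR T n) (f g k : E' →ₗ[ℚ] E) :
    TR (fun a b c => T (f a) (g b) (k c)) n := by
  obtain ⟨κ, i, u, v, w, hc, h⟩ := h
  exact ⟨κ, i, fun r => u r ∘ₗ f, fun r => v r ∘ₗ g, fun r => w r ∘ₗ k, hc,
    fun a b c => by simp [h]⟩

theorem TR.zero : TR (fun _ _ _ : E => (0 : ℚ)) 0 :=
  ⟨Empty, inferInstance, fun _ => 0, fun _ => 0, fun _ => 0, by simp, by simp⟩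

theorem TR.sum {α : Type} (s : Finset α) (T : α → E → E → E → ℚ) (n : ℕ)
    (h : ∀ i ∈ s, TR (T i) n) : TR (fun a b c => ∑ i ∈ s, T i a b c) (s.card * n) := by
  classical
  induction s using Finset.induction_on with
  | empty => simpa using TR.zero
  | insert i s hi ih =>
    rw [Finset.card_insert_of_notMem hi, add_mul, one_mul, add_comm]
    refine ((h i (Finset.mem_insert_self i s)).add
      (ih fun j hj => h j (Finset.mem_insert_of_mem hj))).congr ?_
    intro a b c
    rw [Finset.sum_insert hi]

end TRlemmas

/-! ### The matrix multiplication form and its tensor products -/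

/-- The matrix multiplication trilinear form. -/
def mmF (ι : Type) [Fintype ι] (A B C : Matrix ι ι ℚ) : ℚ :=
  ∑ i, ∑ j, ∑ k, A i j * B j k * C k i

theorem mmF_eq_trace {ι : Type} [Fintype ι] (A B C : Matrix ι ι ℚ) :
    mmF ι A B C = (A * B * C).trace := by
  simp only [mmF, Matrix.trace, Matrix.diag, Matrix.mul_apply, Finset.sum_mul]
  refine Finset.sum_congr rfl fun i _ => ?_
  rw [Finset.sum_comm]

/-- Apply a linear form to every block. -/
def blkMap {ι ι' : Type} (u : Matrix ι ι ℚ →ₗ[ℚ] ℚ) :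
    Matrix (ι × ι') (ι × ι') ℚ →ₗ[ℚ] Matrix ι' ι' ℚ where
  toFun A := Matrix.of fun i' j' => u (Matrix.of fun i j => A (i, i') (j, j'))
  map_add' A B := by
    ext i' j'
    simp only [Matrix.of_apply, Matrix.add_apply]
    rw [← map_add]; rfl
  map_smul' q A := by
    ext i' j'
    simp only [Matrix.of_apply, Matrix.smul_apply, RingHom.id_apply]
    rw [← map_smul]; rfl

theorem TR.mm_prod {ι ι' : Type} [Fintype ι] [Fintype ι'] {m n : ℕ}
    (h : TR (mmF ι) m) (h' : TR (mmF ι') n) : TR (mmF (ι × ι')) (m * n) := by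
  obtain ⟨κ, i, u, v, w, hc, h⟩ := h
  have h1 : TR (fun A B C => ∑ r ∈ (Finset.univ : Finset κ),
      mmF ι' (blkMap (ι' := ι') (u r) A) (blkMap (v r) B) (blkMap (w r) C))
      ((Finset.univ : Finset κ).card * n) :=
    TR.sum _ _ _ fun r _ => h'.comp _ _ _
  refine (h1.congr ?_).mono (Nat.mul_le_mul_right _ (by simpa using hc))
  intro A B C
  have e : ∀ i' j' k' : ι', ∑ r, u r (Matrix.of fun i j => A (i, i') (j, j')) *
      v r (Matrix.of fun i j => B (i, j') (j, k')) * w r (Matrix.of fun i j => C (i, k') (j, i'))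
      = ∑ i, ∑ j, ∑ k, A (i, i') (j, j') * B (j, j') (k, k') * C (k, k') (i, i') := by
    intro i' j' k'
    rw [← h]; rfl
  simp only [mmF, blkMap, LinearMap.coe_mk, AddHom.coe_mk, Matrix.of_apply]
  simp only [Fintype.sum_prod_type]
  rw [Finset.sum_comm, Finset.sum_comm (s := (Finset.univ : Finset κ))]
  refine Finset.sum_congr rfl fun i' _ => ?_
  rw [Finset.sum_comm (s := (Finset.univ : Finset κ)),
    Finset.sum_congr rfl fun i _ => Finset.sum_comm, Finset.sum_comm]
  refine Finset.sum_congr rfl fun j' _ => ?_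
  rw [Finset.sum_comm (s := (Finset.univ : Finset κ)),
    Finset.sum_congr rfl fun i _ => Finset.sum_congr rfl fun j _ => Finset.sum_comm,
    Finset.sum_congr rfl fun i _ => Finset.sum_comm, Finset.sum_comm]
  refine Finset.sum_congr rfl fun k' _ => ?_
  exact (e i' j' k').symm

theorem TR.mm_equiv {ι ι' : Type} [Fintype ι] [Fintype ι'] (e : ι ≃ ι') {n : ℕ}
    (h : TR (mmF ι) n) : TR (mmF ι') n := by
  let f : Matrix ι' ι' ℚ →ₗ[ℚ] Matrix ι ι ℚ :=
    (Matrix.reindexLinearEquiv ℚ ℚ e.symm e.symm).toLinearMap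
  refine (h.comp f f f).congr ?_
  intro A B C
  simp only [mmF, f, LinearEquiv.coe_coe, Matrix.coe_reindexLinearEquiv, Matrix.reindex_apply,
    Matrix.submatrix_apply, Equiv.symm_symm]
  rw [← Equiv.sum_comp e]
  refine Finset.sum_congr rfl fun i _ => ?_
  rw [← Equiv.sum_comp e]
  refine Finset.sum_congr rfl fun j _ => ?_
  rw [← Equiv.sum_comp e]

theorem exists_alg_of_TR (n t : ℕ) (h : TR (mmF (Fin n)) t) :
    ∃ (U V W : Matrix (Fin t) (Fin (n * n)) ℚ), IsMMAlg n n n t U V W := by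
  obtain ⟨κ, i, u, v, w, hc, h⟩ := h
  obtain ⟨e⟩ : Nonempty (κ ↪ Fin t) := Function.Embedding.nonempty_of_card_le (by simpa using hc)
  have key : ∀ u : κ → Matrix (Fin n) (Fin n) ℚ →ₗ[ℚ] ℚ,
      ∃ U : Matrix (Fin t) (Fin (n * n)) ℚ, ∀ A, U.mulVec (vec A) =
        Function.extend e (fun r => u r A) 0 := by
    intro u
    refine ⟨Matrix.of fun q x => Function.extend e
      (fun r => u r (Matrix.single x.divNat x.modNat 1)) 0 q, ?_⟩
    intro A
    ext q
    by_cases hq : ∃ r, e r = q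
    · obtain ⟨r, rfl⟩ := hq
      simp only [Matrix.mulVec, dotProduct, Matrix.of_apply, e.injective.extend_apply, _root_.vec]
      have := (finProdFinEquiv (m := n) (n := n)).symm.sum_comp
        (fun p : Fin n × Fin n => u r (Matrix.single p.1 p.2 1) * A p.1 p.2)
      simp only [finProdFinEquiv_symm_apply] at this
      rw [this]
      conv_rhs => rw [Matrix.matrix_eq_sum_single A]
      simp only [map_sum, Fintype.sum_prod_type]
      refine Finset.sum_congr rfl fun i _ => Finset.sum_congr rfl fun j _ => ?_
      have : Matrix.single i j (A i j) = A i j • Matrix.single i j (1 : ℚ) := by simp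
      rw [this, map_smul, smul_eq_mul, mul_comm]
    · simp [Matrix.mulVec, dotProduct, Function.extend_apply' _ _ _ hq]
  obtain ⟨U, hU⟩ := key u
  obtain ⟨V, hV⟩ := key v
  obtain ⟨W, hW⟩ := key w
  refine ⟨U, V, W, ?_⟩
  intro A B C
  rw [← mmF_eq_trace, h, hU, hV, hW]
  refine Finset.sum_of_injOn e (e.injective.injOn) (by simp) ?_ ?_
  · intro q _ hq
    have hq : ¬ ∃ r, e r = q := by simpa using hq
    simp [Function.extend_apply' _ _ _ hq]
  · intro r _
    simp [e.injective.extend_apply]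

/-! ### Trilinear aggregation -/

/-- The sign attached to a half of the index set. -/
def sg (x : Bool) : ℚ := if x then -1 else 1

/-- The aggregate of the blocks `1 = (i,j)`, `2 = (j,k)`, `3 = (k,i)`. -/
def agg (a1 a2 a3 b1 b2 b3 c1 c2 c3 : Matrix Bool Bool ℚ) (x y z : Bool) : ℚ :=
  (a1 x y + a2 z x + a3 y z) * (sg x * b2 y z + sg z * b3 x y + sg y * b1 z x) *
    (sg x * c3 z x + sg z * c1 y z + sg y * c2 x y)

/-- Sum of the aggregates over all halves. -/
def aggS (a1 a2 a3 b1 b2 b3 c1 c2 c3 : Matrix Bool Bool ℚ) : ℚ :=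
  ∑ x, ∑ y, ∑ z, agg a1 a2 a3 b1 b2 b3 c1 c2 c3 x y z

/-- The correction form. -/
def corr (a b c : Matrix Bool Bool ℚ) : ℚ :=
  ∑ x, ∑ y, ∑ z, sg y * sg z * a x y * b z x * c y z

/-- Part of the aggregate that contains `a1`, without the cancelling terms. -/
def part (a1 b1 b2 b3 c1 c2 c3 : Matrix Bool Bool ℚ) : ℚ :=
  ∑ x, ∑ y, ∑ z, (a1 x y * b2 y z * c3 z x
    + sg y * sg z * a1 x y * b1 z x * c1 y z
    + a1 x y * b2 y z * (sg x * sg z * c1 y z) + a1 x y * b2 y z * (sg x * sg y * c2 x y)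
    + a1 x y * b3 x y * (sg x * sg z * c3 z x) + a1 x y * b3 x y * c1 y z
    + a1 x y * b1 z x * (sg x * sg y * c3 z x) + a1 x y * b1 z x * c2 x y)

theorem aggS_eq_part (a1 a2 a3 b1 b2 b3 c1 c2 c3 : Matrix Bool Bool ℚ) :
    aggS a1 a2 a3 b1 b2 b3 c1 c2 c3 = part a1 b1 b2 b3 c1 c2 c3 + part a2 b2 b3 b1 c2 c3 c1
      + part a3 b3 b1 b2 c3 c1 c2 := by
  simp only [aggS, agg, part, Fintype.sum_bool, sg]
  simp
  ring

theorem aggS_rot (a1 a2 a3 b1 b2 b3 c1 c2 c3 : Matrix Bool Bool ℚ) :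
    aggS a1 a2 a3 b1 b2 b3 c1 c2 c3 = aggS a2 a3 a1 b2 b3 b1 c2 c3 c1 := by
  rw [aggS_eq_part, aggS_eq_part]; ring

/-- The `(i,j)` block. -/
def blk {ι : Type} (i j : ι) : Matrix (ι × Bool) (ι × Bool) ℚ →ₗ[ℚ] Matrix Bool Bool ℚ where
  toFun A := Matrix.of fun x y => A (i, x) (j, y)
  map_add' _ _ := rfl
  map_smul' _ _ := rfl

theorem blk_apply {ι : Type} (i j : ι) (A : Matrix (ι × Bool) (ι × Bool) ℚ) (x y : Bool) :
    blk i j A x y = A (i, x) (j, y) := rfl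

/-- The weighted aggregate at the triple `(i,j,k)`. -/
def aggT {ι : Type} (w : ι → ℚ) (i j k : ι) (a b c : Matrix (ι × Bool) (ι × Bool) ℚ) : ℚ :=
  w i * w j * w k * aggS (blk i j a) (blk j k a) (blk k i a) (blk i j b) (blk j k b) (blk k i b)
    (blk i j c) (blk j k c) (blk k i c)

/-- The weighted part at the triple `(i,j,k)`. -/
def partT {ι : Type} (w : ι → ℚ) (i j k : ι) (a b c : Matrix (ι × Bool) (ι × Bool) ℚ) : ℚ :=
  w i * w j * w k * part (blk i j a) (blk i j b) (blk j k b) (blk k i b)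
    (blk i j c) (blk j k c) (blk k i c)

/-- All weighted row and column sums within blocks vanish. -/
def ZS {ι : Type} [Fintype ι] (w : ι → ℚ) (a : Matrix (ι × Bool) (ι × Bool) ℚ) : Prop :=
  (∀ i x y, ∑ j, w j * a (i, x) (j, y) = 0) ∧ (∀ j x y, ∑ i, w i * a (i, x) (j, y) = 0)

theorem sum3_rot {ι : Type} [Fintype ι] (f : ι → ι → ι → ℚ) :
    ∑ i, ∑ j, ∑ k, f j k i = ∑ i, ∑ j, ∑ k, f i j k := by
  rw [Finset.sum_comm]
  exact Finset.sum_congr rfl fun i _ => Finset.sum_comm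

theorem sum_aggT {ι : Type} [Fintype ι] (w : ι → ℚ) (a b c : Matrix (ι × Bool) (ι × Bool) ℚ) :
    ∑ i, ∑ j, ∑ k, aggT w i j k a b c = 3 * ∑ i, ∑ j, ∑ k, partT w i j k a b c := by
  have h : ∀ i j k, aggT w i j k a b c =
      partT w i j k a b c + partT w j k i a b c + partT w k i j a b c := by
    intro i j k
    simp only [aggT, partT, aggS_eq_part]; ring
  simp only [h, Finset.sum_add_distrib]
  rw [sum3_rot (fun i j k => partT w i j k a b c),
    sum3_rot (fun i j k => partT w j k i a b c),
    sum3_rot (fun i j k => partT w i j k a b c)]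
  ring

theorem sum_partT {ι : Type} [Fintype ι] (w : ι → ℚ) (a b c : Matrix (ι × Bool) (ι × Bool) ℚ)
    (ha : ZS w a) (hb : ZS w b) (hc : ZS w c) :
    ∑ i, ∑ j, ∑ k, partT w i j k a b c =
      (∑ i, ∑ j, ∑ k, ∑ x, ∑ y, ∑ z,
        w i * w j * w k * (a (i, x) (j, y) * b (j, y) (k, z) * c (k, z) (i, x))) +
      (∑ k, w k) * ∑ i, ∑ j, w i * w j * corr (blk i j a) (blk i j b) (blk i j c) := by
  -- sums over the last index
  have hk : ∀ i j, ∑ k, partT w i j k a b c = (∑ k, ∑ x, ∑ y, ∑ z,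
        w i * w j * w k * (a (i, x) (j, y) * b (j, y) (k, z) * c (k, z) (i, x))) +
      (∑ k, w k) * (w i * w j * corr (blk i j a) (blk i j b) (blk i j c)) +
      (∑ k, ∑ x, ∑ y, ∑ z, (sg x * sg y * w j * w k * b (j, y) (k, z) * c (j, x) (k, y)) *
          (w i * a (i, x) (j, y))) +
      (∑ k, ∑ x, ∑ y, ∑ z, (sg x * sg z * w i * w k * b (k, x) (i, y) * c (k, z) (i, x)) *
          (w j * a (i, x) (j, y))) := by
    intro i j
    have h1 : ∀ k, partT w i j k a b c = (∑ x, ∑ y, ∑ z,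
        w i * w j * w k * (a (i, x) (j, y) * b (j, y) (k, z) * c (k, z) (i, x))) +
      w k * (w i * w j * corr (blk i j a) (blk i j b) (blk i j c)) +
      (∑ x, ∑ y, ∑ z, (sg x * sg y * w j * w k * b (j, y) (k, z) * c (j, x) (k, y)) *
          (w i * a (i, x) (j, y))) +
      (∑ x, ∑ y, ∑ z, (sg x * sg z * w i * w k * b (k, x) (i, y) * c (k, z) (i, x)) *
          (w j * a (i, x) (j, y))) +
      (∑ x, ∑ y, ∑ z, (
        (w i * w j * a (i, x) (j, y) * sg x * sg z * c (i, y) (j, z)) * (w k * b (j, y) (k, z)) +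
        (w i * w j * a (i, x) (j, y) * c (i, y) (j, z)) * (w k * b (k, x) (i, y)) +
        (w i * w j * a (i, x) (j, y) * sg x * sg y * b (i, z) (j, x)) * (w k * c (k, z) (i, x)) +
        (w i * w j * a (i, x) (j, y) * b (i, z) (j, x)) * (w k * c (j, x) (k, y)))) := by
      intro k
      simp only [partT, part, corr, blk_apply,
        Finset.mul_sum, ← Finset.sum_add_distrib]
      refine Finset.sum_congr rfl fun x _ => Finset.sum_congr rfl fun y _ =>
        Finset.sum_congr rfl fun z _ => ?_
      ring
    have h2 : ∑ k, (∑ x, ∑ y, ∑ z, (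
        (w i * w j * a (i, x) (j, y) * sg x * sg z * c (i, y) (j, z)) * (w k * b (j, y) (k, z)) +
        (w i * w j * a (i, x) (j, y) * c (i, y) (j, z)) * (w k * b (k, x) (i, y)) +
        (w i * w j * a (i, x) (j, y) * sg x * sg y * b (i, z) (j, x)) * (w k * c (k, z) (i, x)) +
        (w i * w j * a (i, x) (j, y) * b (i, z) (j, x)) * (w k * c (j, x) (k, y)))) = 0 := by
      rw [Finset.sum_comm]
      refine Finset.sum_eq_zero fun x _ => ?_
      rw [Finset.sum_comm]
      refine Finset.sum_eq_zero fun y _ => ?_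
      rw [Finset.sum_comm]
      refine Finset.sum_eq_zero fun z _ => ?_
      simp only [Finset.sum_add_distrib, ← Finset.mul_sum, hb.1, hb.2, hc.1, hc.2]
      ring
    simp only [h1, Finset.sum_add_distrib, ← Finset.sum_mul] at h2 ⊢
    rw [h2, add_zero]
  simp only [hk, Finset.sum_add_distrib]
  have h3 : ∑ i, ∑ j, ∑ k, ∑ x, ∑ y, ∑ z,
      (sg x * sg y * w j * w k * b (j, y) (k, z) * c (j, x) (k, y)) * (w i * a (i, x) (j, y))
      = 0 := by
    rw [Finset.sum_comm]
    refine Finset.sum_eq_zero fun j _ => ?_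
    rw [Finset.sum_comm]
    refine Finset.sum_eq_zero fun k _ => ?_
    rw [Finset.sum_comm]
    refine Finset.sum_eq_zero fun x _ => ?_
    rw [Finset.sum_comm]
    refine Finset.sum_eq_zero fun y _ => ?_
    rw [Finset.sum_comm]
    refine Finset.sum_eq_zero fun z _ => ?_
    rw [← Finset.mul_sum, ha.2, mul_zero]
  have h4 : ∑ i, ∑ j, ∑ k, ∑ x, ∑ y, ∑ z,
      (sg x * sg z * w i * w k * b (k, x) (i, y) * c (k, z) (i, x)) * (w j * a (i, x) (j, y))
      = 0 := by
    refine Finset.sum_eq_zero fun i _ => ?_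
    rw [Finset.sum_comm]
    refine Finset.sum_eq_zero fun k _ => ?_
    rw [Finset.sum_comm]
    refine Finset.sum_eq_zero fun x _ => ?_
    rw [Finset.sum_comm]
    refine Finset.sum_eq_zero fun y _ => ?_
    rw [Finset.sum_comm]
    refine Finset.sum_eq_zero fun z _ => ?_
    rw [← Finset.mul_sum, ha.1, mul_zero]
  rw [h3, h4]
  simp only [← Finset.mul_sum]
  ring

/-- Representatives of the non-constant triples up to rotation. -/
def reps (ι : Type) [Fintype ι] [LinearOrder ι] : Finset (ι × ι × ι) :=
  Finset.univ.filter fun t => t.1 < t.2.1 ∧ t.1 ≤ t.2.2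

theorem sum_reps {ι : Type} [Fintype ι] [LinearOrder ι] (f : ι → ι → ι → ℚ)
    (hf : ∀ i j k, f i j k = f j k i) :
    ∑ i, ∑ j, ∑ k, f i j k = 3 * (∑ t ∈ reps ι, f t.1 t.2.1 t.2.2) + ∑ i, f i i i := by
  have h0 : ∑ t ∈ reps ι, f t.1 t.2.1 t.2.2 =
      ∑ i, ∑ j, ∑ k, if i < j ∧ i ≤ k then f i j k else 0 := by
    simp only [reps, Finset.sum_filter, Fintype.sum_prod_type]
  have h1 : ∑ i, f i i i = ∑ i, ∑ j, ∑ k, if i = j ∧ i = k then f i j k else 0 := by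
    refine Finset.sum_congr rfl fun i _ => ?_
    simp [ite_and]
  have h2 : ∑ i, ∑ j, ∑ k, (if i < j ∧ i ≤ k then f i j k else 0) =
      ∑ i, ∑ j, ∑ k, if j < k ∧ j ≤ i then f i j k else 0 := by
    rw [← sum3_rot (fun i j k => if i < j ∧ i ≤ k then f i j k else 0)]
    simp only [← hf]
  have h3 : ∑ i, ∑ j, ∑ k, (if i < j ∧ i ≤ k then f i j k else 0) =
      ∑ i, ∑ j, ∑ k, if k < i ∧ k ≤ j then f i j k else 0 := by
    rw [h2, ← sum3_rot (fun i j k => if j < k ∧ j ≤ i then f i j k else 0)]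
    simp only [← hf]
  have h4 : ∀ A B C D : ℚ, A = B → A = C → 3 * A + D = A + B + C + D := by
    intro A B C D h h'; linarith
  rw [h0, h1, h4 _ _ _ _ h2 h3]
  simp only [← Finset.sum_add_distrib]
  refine Finset.sum_congr rfl fun i _ => Finset.sum_congr rfl fun j _ =>
    Finset.sum_congr rfl fun k _ => ?_
  rcases lt_trichotomy i j with h | h | h <;> rcases lt_trichotomy j k with h' | h' | h' <;>
    rcases lt_trichotomy i k with h'' | h'' | h'' <;> grind

theorem main_identity {ι : Type} [Fintype ι] [LinearOrder ι] (w : ι → ℚ)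
    (a b c : Matrix (ι × Bool) (ι × Bool) ℚ)
    (ha : ZS w a) (hb : ZS w b) (hc : ZS w c) :
    (∑ i, ∑ j, ∑ k, ∑ x, ∑ y, ∑ z,
        w i * w j * w k * (a (i, x) (j, y) * b (j, y) (k, z) * c (k, z) (i, x))) =
      (∑ t ∈ reps ι, aggT w t.1 t.2.1 t.2.2 a b c) +
      ((∑ t ∈ (Finset.univ : Finset ι).offDiag,
        (-(∑ k, w k) * (w t.1 * w t.2)) *
          corr (blk t.1 t.2 a) (blk t.1 t.2 b) (blk t.1 t.2 c)) +
      ∑ i, (w i * w i * w i / 3 * aggS (blk i i a) (blk i i a) (blk i i a)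
          (blk i i b) (blk i i b) (blk i i b) (blk i i c) (blk i i c) (blk i i c) -
        (∑ k, w k) * (w i * w i) * corr (blk i i a) (blk i i b) (blk i i c))) := by
  have h1 := sum_aggT w a b c
  rw [sum_partT w a b c ha hb hc, sum_reps (fun i j k => aggT w i j k a b c)
    (fun i j k => by simp only [aggT]; rw [aggS_rot]; ring)] at h1
  have h2 : ∑ i, ∑ j, w i * w j * corr (blk i j a) (blk i j b) (blk i j c) =
      (∑ t ∈ (Finset.univ : Finset ι).offDiag,
        w t.1 * w t.2 * corr (blk t.1 t.2 a) (blk t.1 t.2 b) (blk t.1 t.2 c)) +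
      ∑ i, w i * w i * corr (blk i i a) (blk i i b) (blk i i c) := by
    rw [← Finset.sum_product', ← Finset.diag_union_offDiag,
      Finset.sum_union (Finset.disjoint_diag_offDiag _), Finset.sum_diag, add_comm]
  rw [h2] at h1
  simp only [Finset.sum_sub_distrib, mul_assoc, ← Finset.mul_sum, aggT, div_mul_eq_mul_div,
    ← Finset.sum_div, neg_mul, Finset.sum_neg_distrib] at h1 ⊢
  linarith

/-! ### Local ranks -/

/-- A linear form on `2 × 2` matrices. -/
def lin (p : Fin 4 → ℚ) : Matrix Bool Bool ℚ →ₗ[ℚ] ℚ where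
  toFun A := p 0 * A false false + p 1 * A false true + p 2 * A true false + p 3 * A true true
  map_add' A B := by simp only [Matrix.add_apply]; ring
  map_smul' q A := by simp only [Matrix.smul_apply, smul_eq_mul, RingHom.id_apply]; ring

theorem lin_apply (p : Fin 4 → ℚ) (A : Matrix Bool Bool ℚ) : lin p A =
    p 0 * A false false + p 1 * A false true + p 2 * A true false + p 3 * A true true := rfl

theorem TR_lin {n : ℕ} (T : Matrix Bool Bool ℚ → Matrix Bool Bool ℚ → Matrix Bool Bool ℚ → ℚ)
    (u v w : Fin n → Fin 4 → ℚ)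
    (h : ∀ a b c, T a b c = ∑ r, lin (u r) a * lin (v r) b * lin (w r) c) : TR T n :=
  ⟨Fin n, inferInstance, fun r => lin (u r), fun r => lin (v r), fun r => lin (w r), by simp, h⟩

/-- The correction form is a twisted `2 × 2` matrix product, of rank seven (Strassen). -/
theorem TR_corr : TR corr 7 := by
  refine TR_lin _
    ![![1, 0, 0, 1], ![0, 0, 1, 1], ![1, 0, 0, 0], ![0, 0, 0, 1], ![1, 1, 0, 0],
      ![-1, 0, 1, 0], ![0, 1, 0, -1]]
    ![![1, 0, 0, 1], ![0, 1, 0, -1], ![0, 0, 1, 1], ![1, 1, 0, 0], ![-1, 0, 1, 0],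
      ![0, 0, 0, 1], ![1, 0, 0, 0]]
    ![![1, 0, 0, 1], ![1, 0, 0, 0], ![0, -1, 0, -1], ![-1, 0, -1, 0], ![0, 0, 0, 1],
      ![1, -1, 0, 0], ![0, 0, -1, 1]] ?_
  intro a b c
  simp [corr, sg, Fin.sum_univ_succ, lin_apply]
  ring

/-- The diagonal form has rank seven at weight ratio nine. -/
theorem TR_diag : TR (fun a b c => 1 / 3 * aggS a a a b b b c c c - 9 * corr a b c) 7 := by
  refine TR_lin _
    ![![0, -1, -1, -1],
    ![1/8, 1/8, -1, 0],
    ![-1, 0, -1, 0],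
    ![0, 1/8, -1, 1/8],
    ![-1, -1, -1, 0],
    ![0, 0, -1, -1],
    ![1, 0, 0, -1]]
    ![![1, -2/9, 7/9, 2/9],
    ![0, 0, 1, -1],
    ![0, 0, 1, 0],
    ![0, 1, 1, -1],
    ![1/7, -1/7, 1, 1/7],
    ![-1, 1, -1, 0],
    ![-1, 1, 0, -1]]
    ![![9/7, -9/7, -9, -9/7],
    ![-8, 8, -8, 0],
    ![0, -9, -9, -9],
    ![8, 0, 8, 0],
    ![-2, 2, 7, 9],
    ![0, 0, -9, 0],
    ![9/7, -9/7, 0, -9/7]] ?_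
  intro a b c
  simp [aggS, agg, corr, sg, Fin.sum_univ_succ, lin_apply]
  ring

theorem TR_agg {E : Type} [AddCommGroup E] [Module ℚ E] (f1 f2 f3 : E →ₗ[ℚ] Matrix Bool Bool ℚ) :
    TR (fun a b c => aggS (f1 a) (f2 a) (f3 a) (f1 b) (f2 b) (f3 b) (f1 c) (f2 c) (f3 c)) 8 := by
  let ev : Bool → Bool → Matrix Bool Bool ℚ →ₗ[ℚ] ℚ := fun x y => Matrix.entryLinearMap ℚ ℚ x y
  have h : ∀ t ∈ (Finset.univ : Finset (Bool × Bool × Bool)),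
      TR (fun a b c => agg (f1 a) (f2 a) (f3 a) (f1 b) (f2 b) (f3 b) (f1 c) (f2 c) (f3 c)
        t.1 t.2.1 t.2.2) 1 := by
    rintro ⟨x, y, z⟩ -
    exact (TR.one (ev x y ∘ₗ f1 + ev z x ∘ₗ f2 + ev y z ∘ₗ f3)
      (sg x • ev y z ∘ₗ f2 + sg z • ev x y ∘ₗ f3 + sg y • ev z x ∘ₗ f1)
      (sg x • ev z x ∘ₗ f3 + sg z • ev y z ∘ₗ f1 + sg y • ev x y ∘ₗ f2)).congr
      fun a b c => rfl
  refine (TR.sum _ _ 1 h).congr ?_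
  intro a b c
  simp only [aggS, Fintype.sum_prod_type]

/-! ### Assembly -/

/-- Weights. -/
def wt (i : Fin 23) : ℚ := if i = Fin.last 22 then -13 else 1

theorem sum_wt : ∑ k, wt k = 9 := by
  simp [wt, Fin.sum_univ_castSucc, Fin.castSucc_ne_last]
  norm_num

/-- The weighted trilinear form, on zero-sum matrices, has small rank. -/
theorem TR_weighted {E : Type} [AddCommGroup E] [Module ℚ E]
    (f g h : E →ₗ[ℚ] Matrix (Fin 23 × Bool) (Fin 23 × Bool) ℚ)
    (hf : ∀ a, ZS wt (f a)) (hg : ∀ a, ZS wt (g a)) (hh : ∀ a, ZS wt (h a)) :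
    TR (fun a b c => ∑ i, ∑ j, ∑ k, ∑ x, ∑ y, ∑ z,
        wt i * wt j * wt k * (f a (i, x) (j, y) * g b (j, y) (k, z) * h c (k, z) (i, x)))
      36096 := by
  have h1 : TR (fun a b c => ∑ t ∈ reps (Fin 23), aggT wt t.1 t.2.1 t.2.2 a b c)
      ((reps (Fin 23)).card * 8) :=
    TR.sum _ _ _ fun t _ => (TR_agg _ _ _).smul _
  have h2 : TR (fun a b c => ∑ t ∈ (Finset.univ : Finset (Fin 23)).offDiag,
      (-(∑ k, wt k) * (wt t.1 * wt t.2)) *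
        corr (blk t.1 t.2 a) (blk t.1 t.2 b) (blk t.1 t.2 c))
      ((Finset.univ : Finset (Fin 23)).offDiag.card * 7) :=
    TR.sum _ _ _ fun t _ => (TR_corr.comp _ _ _).smul _
  have h3 : TR (fun a b c => ∑ i : Fin 22, (1 / 3 * aggS (blk i.castSucc i.castSucc a)
      (blk i.castSucc i.castSucc a) (blk i.castSucc i.castSucc a)
      (blk i.castSucc i.castSucc b) (blk i.castSucc i.castSucc b) (blk i.castSucc i.castSucc b)
      (blk i.castSucc i.castSucc c) (blk i.castSucc i.castSucc c) (blk i.castSucc i.castSucc c) -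
        9 * corr (blk i.castSucc i.castSucc a) (blk i.castSucc i.castSucc b)
          (blk i.castSucc i.castSucc c)))
      ((Finset.univ : Finset (Fin 22)).card * 7) :=
    TR.sum _ _ _ fun t _ => TR_diag.comp _ _ _
  have h4 := ((TR_agg (blk (Fin.last 22) (Fin.last 22)) (blk (Fin.last 22) (Fin.last 22))
    (blk (Fin.last 22) (Fin.last 22))).smul (-13 * -13 * -13 / 3)).add
    ((TR_corr.comp (blk (Fin.last 22) (Fin.last 22)) (blk (Fin.last 22) (Fin.last 22))
    (blk (Fin.last 22) (Fin.last 22))).smul (-(9 * (-13 * -13))))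
  have c1 : (reps (Fin 23)).card = 4048 := by decide +kernel
  have c2 : (Finset.univ : Finset (Fin 23)).offDiag.card = 506 := by
    rw [Finset.offDiag_card]; simp
  have c3 : (Finset.univ : Finset (Fin 22)).card = 22 := by simp
  have h5 := (h1.add (h2.add (h3.add h4))).comp f g h
  rw [c1, c2, c3] at h5
  refine (h5.congr ?_).mono (by norm_num)
  intro a b c
  rw [main_identity wt _ _ _ (hf a) (hg b) (hh c)]
  congr 1
  congr 1
  rw [Fin.sum_univ_castSucc, sum_wt]
  simp only [wt, Fin.castSucc_ne_last, if_true, if_false]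
  congr 1
  · refine Finset.sum_congr rfl fun i _ => ?_
    ring
  · ring

/-- Row extension. -/
def exE : Matrix (Fin 23) (Fin 22) ℚ :=
  Matrix.of fun i j => if i = Fin.last 22 then 1 / 13 else if i = j.castSucc then 1 else 0

/-- Column extension. -/
def exF : Matrix (Fin 22) (Fin 23) ℚ :=
  Matrix.of fun k j => (if j = k.castSucc then 1 else 0) - 1 / 9

theorem wt_castSucc (i : Fin 22) : wt i.castSucc = 1 := if_neg (Fin.castSucc_ne_last i)

theorem wt_last : wt (Fin.last 22) = -13 := if_pos rfl

theorem exE_castSucc (i j : Fin 22) : exE i.castSucc j = if i = j then 1 else 0 := by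
  unfold exE
  rw [Matrix.of_apply, if_neg (Fin.castSucc_ne_last i)]
  simp only [Fin.castSucc_inj]

theorem exE_last (j : Fin 22) : exE (Fin.last 22) j = 1 / 13 := by
  unfold exE
  rw [Matrix.of_apply, if_pos rfl]

theorem wt_exE (j : Fin 22) : ∑ i, wt i * exE i j = 0 := by
  rw [Fin.sum_univ_castSucc]
  simp only [wt_castSucc, wt_last, exE_castSucc, exE_last, one_mul, Finset.sum_ite_eq',
    Finset.mem_univ, if_true]
  norm_num

theorem exF_wt (k : Fin 22) : ∑ j, wt j * exF k j = 0 := by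
  have h : ∀ j, wt j * exF k j = (if j = k.castSucc then wt j else 0) - wt j * (1 / 9) := by
    intro j
    simp only [exF, Matrix.of_apply]
    split_ifs <;> ring
  simp only [h, Finset.sum_sub_distrib, ← Finset.sum_mul, sum_wt]
  simp only [Finset.sum_ite_eq', Finset.mem_univ, if_true, wt_castSucc]
  norm_num

theorem exF_exE (k l : Fin 22) : ∑ j, exF k j * wt j * exE j l = if k = l then 1 else 0 := by
  have h : ∀ j, exF k j * wt j * exE j l =
      (if j = k.castSucc then wt j * exE j l else 0) - (1 / 9) * (wt j * exE j l) := by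
    intro j
    simp only [exF, Matrix.of_apply]
    split_ifs <;> ring
  simp only [h, Finset.sum_sub_distrib, ← Finset.mul_sum, wt_exE]
  simp only [Finset.sum_ite_eq', Finset.mem_univ, if_true, wt_castSucc, exE_castSucc, one_mul,
    mul_zero, sub_zero]

/-- The extension of a matrix to a zero-sum matrix. -/
def ext23 : Matrix (Fin 22 × Bool) (Fin 22 × Bool) ℚ →ₗ[ℚ]
    Matrix (Fin 23 × Bool) (Fin 23 × Bool) ℚ where
  toFun A := Matrix.of fun p q => ∑ i, ∑ j, exE p.1 i * A (i, p.2) (j, q.2) * exF j q.1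
  map_add' A B := by
    ext p q
    simp only [Matrix.of_apply, Matrix.add_apply, mul_add, add_mul, Finset.sum_add_distrib]
  map_smul' r A := by
    ext p q
    simp only [Matrix.of_apply, Matrix.smul_apply, smul_eq_mul, RingHom.id_apply, Finset.mul_sum]
    refine Finset.sum_congr rfl fun i _ => Finset.sum_congr rfl fun j _ => ?_
    ring

theorem ext23_apply (A : Matrix (Fin 22 × Bool) (Fin 22 × Bool) ℚ) (p q : Fin 23 × Bool) :
    ext23 A p q = ∑ i, ∑ j, exE p.1 i * A (i, p.2) (j, q.2) * exF j q.1 := rfl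

theorem ZS_ext23 (A : Matrix (Fin 22 × Bool) (Fin 22 × Bool) ℚ) : ZS wt (ext23 A) := by
  constructor
  · intro i x y
    simp only [ext23_apply, Finset.mul_sum]
    rw [Finset.sum_comm]
    refine Finset.sum_eq_zero fun i' _ => ?_
    rw [Finset.sum_comm]
    refine Finset.sum_eq_zero fun j' _ => ?_
    have : ∀ j, wt j * (exE i i' * A (i', x) (j', y) * exF j' j) =
        (exE i i' * A (i', x) (j', y)) * (wt j * exF j' j) := fun j => by ring
    simp only [this, ← Finset.mul_sum, exF_wt, mul_zero]
  · intro j x y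
    simp only [ext23_apply, Finset.mul_sum]
    rw [Finset.sum_comm]
    refine Finset.sum_eq_zero fun i' _ => ?_
    rw [Finset.sum_comm]
    refine Finset.sum_eq_zero fun j' _ => ?_
    have : ∀ i, wt i * (exE i i' * A (i', x) (j', y) * exF j' j) =
        (A (i', x) (j', y) * exF j' j) * (wt i * exE i i') := fun i => by ring
    simp only [this, ← Finset.mul_sum, wt_exE, mul_zero]

/-- `E ⊗ 1`. -/
def bigE : Matrix (Fin 23 × Bool) (Fin 22 × Bool) ℚ :=
  Matrix.of fun p q => if p.2 = q.2 then exE p.1 q.1 else 0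

/-- `F ⊗ 1`. -/
def bigF : Matrix (Fin 22 × Bool) (Fin 23 × Bool) ℚ :=
  Matrix.of fun p q => if p.2 = q.2 then exF p.1 q.1 else 0

/-- `W ⊗ 1`. -/
def bigW : Matrix (Fin 23 × Bool) (Fin 23 × Bool) ℚ := Matrix.diagonal fun p => wt p.1

theorem ext23_eq (A : Matrix (Fin 22 × Bool) (Fin 22 × Bool) ℚ) : ext23 A = bigE * A * bigF := by
  ext p q
  simp only [ext23_apply, bigE, bigF, Matrix.mul_apply, Matrix.of_apply, Fintype.sum_prod_type,
    ite_mul, mul_ite, zero_mul, mul_zero, Finset.sum_ite_eq, Finset.mem_univ, if_true,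
    Finset.sum_ite_eq', Finset.sum_mul]
  rw [Finset.sum_comm]

theorem bigF_W_E : bigF * bigW * bigE = 1 := by
  ext p q
  rw [Matrix.mul_apply]
  simp only [bigW, Matrix.mul_diagonal, bigE, bigF, Matrix.of_apply,
    Fintype.sum_prod_type, ite_mul, zero_mul, Finset.sum_ite_eq, Finset.mem_univ, if_true,
    mul_ite, mul_zero]
  obtain ⟨k, x⟩ := p
  obtain ⟨l, y⟩ := q
  by_cases h : x = y
  · simp [h, exF_exE, Matrix.one_apply]
  · simp [h, Matrix.one_apply]

theorem weighted_eq (A B C : Matrix (Fin 22 × Bool) (Fin 22 × Bool) ℚ) :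
    mmF (Fin 22 × Bool) A B C = ∑ i, ∑ j, ∑ k, ∑ x, ∑ y, ∑ z, wt i * wt j * wt k *
      (ext23 A (i, x) (j, y) * ext23 B (j, y) (k, z) * ext23 C (k, z) (i, x)) := by
  have h1 : mmF (Fin 23 × Bool) (bigW * ext23 A) (bigW * ext23 B) (bigW * ext23 C) =
      mmF (Fin 22 × Bool) A B C := by
    rw [mmF_eq_trace, mmF_eq_trace, ext23_eq, ext23_eq, ext23_eq]
    have e : bigW * (bigE * A * bigF) * (bigW * (bigE * B * bigF)) * (bigW * (bigE * C * bigF)) =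
        (bigW * bigE) * (A * (bigF * bigW * bigE) * B * (bigF * bigW * bigE) * C * bigF) := by
      simp only [Matrix.mul_assoc]
    rw [e, Matrix.trace_mul_comm, bigF_W_E]
    have e2 : A * 1 * B * 1 * C * bigF * (bigW * bigE) = A * B * C * (bigF * bigW * bigE) := by
      simp only [Matrix.mul_one, Matrix.mul_assoc]
    rw [e2, bigF_W_E, Matrix.mul_one]
  rw [← h1]
  simp only [mmF, bigW, Matrix.diagonal_mul, Fintype.sum_prod_type]
  refine Finset.sum_congr rfl fun i _ => ?_
  rw [Finset.sum_comm]
  refine Finset.sum_congr rfl fun j _ => ?_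
  rw [Finset.sum_congr rfl fun x _ => Finset.sum_comm, Finset.sum_comm]
  refine Finset.sum_congr rfl fun k _ => ?_
  refine Finset.sum_congr rfl fun x _ => Finset.sum_congr rfl fun y _ =>
    Finset.sum_congr rfl fun z _ => ?_
  ring

theorem TR_mm44 : TR (mmF (Fin 22 × Bool)) 36096 :=
  (TR_weighted ext23 ext23 ext23 ZS_ext23 ZS_ext23 ZS_ext23).congr weighted_eq

theorem TR_mm1936 : TR (mmF (Fin 1936)) 1303676064 := by
  have e : (Fin 22 × Bool) × (Fin 22 × Bool) ≃ Fin 1936 :=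
    Fintype.equivFinOfCardEq (by simp)
  exact ((TR_mm44.mm_prod TR_mm44).mm_equiv e).mono (by norm_num)

/-- There exists a `⟨1936,1936,1936;1303676064⟩`-algorithm over `ℚ`. -/
theorem exists_1936_1936_1936_1303676064_algorithm :
    ∃ (U V W : Matrix (Fin 1303676064) (Fin (1936 * 1936)) ℚ),
      IsMMAlg 1936 1936 1936 1303676064 U V W :=
  exists_alg_of_TR 1936 1303676064 TR_mm1936
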